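/- Let p be a prime with p ≥ 3, k an algebraically closed field of characteristic p, and a, b, c ∈ k with a·b − c ≠ 0. Set f := X^{p+1} + a·X^p + b·X + c ∈ k[X]. Then f has exactly p+1 roots in k, all of them simple (so its multiset of roots has p+1 pairwise distinct elements), and for every root z of f one has ∑_{w} (z − w)⁻¹ = 0, where the sum runs over all roots w of f with w ≠ z. -/

import Mathlib

open Polynomial Finset

theorem eval_derivative_prod_X_sub_C {k : Type*} [Field k] [DecidableEq k] (s : Finset k) {z : k}
    (hz : z ∉ s) :
    (derivative (∏ w ∈ s, (X - C w))).eval z =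
      (∏ w ∈ s, (z - w)) * ∑ w ∈ s, (z - w)⁻¹ := by
  rw [derivative_prod_finset, eval_finsetSum, Finset.mul_sum]
  refine Finset.sum_congr rfl fun w hw => ?_
  have hzw : z - w ≠ 0 := sub_ne_zero.mpr fun h => hz (h ▸ hw)
  rw [← Finset.mul_prod_erase s _ hw]
  simp only [derivative_X_sub_C, mul_one, eval_prod, eval_sub, eval_X, eval_C]
  field_simp

/-- A simple root at which the second derivative vanishes satisfies the Bethe ansatz equation. -/
theorem sum_inv_sub_roots_eq_zero {k : Type*} [Field k] [DecidableEq k] (h2 : (2 : k) ≠ 0)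
    {f : k[X]} (hs : f.Splits) (hnd : f.roots.Nodup) {z : k} (hz : z ∈ f.roots)
    (hd : (derivative (derivative f)).eval z = 0) :
    ∑ w ∈ f.roots.toFinset.erase z, (z - w)⁻¹ = 0 := by
  have hf0 : f ≠ 0 := ne_zero_of_mem_roots hz
  set s := f.roots.toFinset.erase z with hs_def
  have hprod : f = C f.leadingCoeff * ((X - C z) * ∏ w ∈ s, (X - C w)) := by
    conv_lhs => rw [hs.eq_prod_roots]
    rw [hs_def, Finset.mul_prod_erase f.roots.toFinset (fun w => X - C w)
      (Multiset.mem_toFinset.mpr hz), Finset.prod, Multiset.toFinset_val, hnd.dedup]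
  have hzs : z ∉ s := Finset.notMem_erase z _
  have hne : ∏ w ∈ s, (z - w) ≠ 0 :=
    Finset.prod_ne_zero_iff.mpr fun w hw => sub_ne_zero.mpr fun h => hzs (h ▸ hw)
  have hg := eval_derivative_prod_X_sub_C s hzs
  generalize ∏ w ∈ s, (X - C w) = g at hprod hg
  rw [hprod] at hd
  simp only [derivative_mul, derivative_add, derivative_C, derivative_X_sub_C, eval_add, eval_mul,
    eval_sub, eval_X, eval_C, zero_mul, zero_add, one_mul, sub_self,
    add_zero, ← two_mul] at hd
  rw [hg] at hd
  have hlc := leadingCoeff_ne_zero.mpr hf0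
  simpa [hlc, h2, hne] using hd

theorem stmt3 {p : ℕ} (hp : p.Prime) (hp3 : 3 ≤ p) {k : Type*} [Field k]
    [IsAlgClosed k] [CharP k p] [DecidableEq k]
    (a b c : k) (habc : a * b - c ≠ 0) (f : k[X])
    (hf : f = X ^ (p + 1) + C a * X ^ p + C b * X + C c) :
    Multiset.card f.roots = p + 1 ∧ f.roots.Nodup ∧
      ∀ z ∈ f.roots, ∑ w ∈ f.roots.toFinset.erase z, (z - w)⁻¹ = 0 := by
  have hderiv : derivative f = X ^ p + C b := by
    simp [hf, derivative_X_pow]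
  have hs : f.Splits := IsAlgClosed.splits f
  have hsep : f.Separable := by
    refine ⟨C (c - a * b)⁻¹, -C (c - a * b)⁻¹ * (X + C a), ?_⟩
    have hne : c - a * b ≠ 0 := fun h => habc (by linear_combination -h)
    have hC : C (c - a * b)⁻¹ * (C c - C a * C b) = (1 : k[X]) := by
      rw [← C_mul, ← C_sub, ← C_mul, inv_mul_cancel₀ hne, C_1]
    rw [hderiv, hf]
    linear_combination hC
  have hnd := nodup_roots hsep
  have h2 : (2 : k) ≠ 0 := by
    intro h
    have := (CharP.cast_eq_zero_iff k p 2).mp (by exact_mod_cast h)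
    have := Nat.le_of_dvd two_pos this
    omega
  refine ⟨?_, hnd, fun z hz => sum_inv_sub_roots_eq_zero h2 hs hnd hz ?_⟩
  · rw [← hs.natDegree_eq_card_roots, hf]
    have := hp.ne_zero
    compute_degree!
    simp [this]
  · simp [hderiv, derivative_X_pow]
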